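/- arXiv:1712.03639 — 3 statements merged into one kernel-verified Lean document; each statement's English description precedes it below -/
import Mathlib

section
/- Let n and r be positive integers with r dividing n, and let C ⊆ M_r(S_n) be a single-error correcting r-regular multipermutation code (i.e., any two distinct codewords are at r-regular Ulam distance at least 3). Then |C| ≤ n! / ((r!)^{n/r} · (1 + (n−1)(n/r − 1))). -/
/-- Length of a longest common subsequence of two lists. -/
noncomputable def lcsLen {α : Type*} (x y : List α) : ℕ :=
  sSup {k | ∃ z : List α, z.length = k ∧ z.Sublist x ∧ z.Sublist y}
/-- The `r`-regular multipermutation `m_σ^r` of `σ`, with values in `{1, …, n/r}`: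
`m_σ^r(i) = j` iff `(j-1)r + 1 ≤ σ(i) ≤ jr` (with `σ(i)` read as a 1-indexed value). -/
def mreg {n : ℕ} (r : ℕ) (σ : Equiv.Perm (Fin n)) : Fin n → ℕ :=
  fun i => (σ i : ℕ) / r + 1
/-- The `r`-regular Ulam distance between length-`n` sequences:
`n` minus the length of a longest common subsequence. -/
noncomputable def mdist {n : ℕ} {α : Type*} (x y : Fin n → α) : ℕ :=
  n - lcsLen (List.ofFn x) (List.ofFn y)
/-- The set `M_r(S_n)` of `r`-regular multipermutations. -/
def Mset (n r : ℕ) : Set (Fin n → ℕ) :=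
  {m | ∃ σ : Equiv.Perm (Fin n), m = mreg r σ}

theorem List.Sublist.exists_common_sublist {α : Type*} {l₁ z : List α} (h₁ : l₁.Sublist z) :
    ∀ {l₂ : List α}, l₂.Sublist z →
      ∃ w : List α, w.Sublist l₁ ∧ w.Sublist l₂ ∧ l₁.length + l₂.length ≤ w.length + z.length := by
  induction h₁ with
  | slnil =>
    intro l₂ h₂
    exact ⟨[], by simp, by simp, by simpa using h₂⟩
  | @cons l₁ z a h ih =>
    intro l₂ h₂
    cases h₂ with
    | cons _ h₂ =>
      obtain ⟨w, hw₁, hw₂, hw⟩ := ih h₂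
      exact ⟨w, hw₁, hw₂, by simp only [List.length_cons]; omega⟩
    | @cons_cons l₂ _ _ h₂ =>
      obtain ⟨w, hw₁, hw₂, hw⟩ := ih h₂
      exact ⟨w, hw₁, hw₂.cons a, by simp only [List.length_cons]; omega⟩
  | @cons_cons l₁ z a h ih =>
    intro l₂ h₂
    cases h₂ with
    | cons _ h₂ =>
      obtain ⟨w, hw₁, hw₂, hw⟩ := ih h₂
      exact ⟨w, hw₁.cons a, hw₂, by simp only [List.length_cons]; omega⟩
    | @cons_cons l₂ _ _ h₂ =>
      obtain ⟨w, hw₁, hw₂, hw⟩ := ih h₂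
      exact ⟨a :: w, hw₁.cons_cons a, hw₂.cons_cons a, by simp only [List.length_cons]; omega⟩

/-- The rearrangements of `l` at Ulam distance at most one from `l`. -/
def unitUlamBall {α : Type*} (l : List α) : Set (List α) :=
  {y | y.Perm l ∧ ∃ z : List α, z.Sublist l ∧ z.Sublist y ∧ l.length ≤ z.length + 1}

theorem cons_mem_unitUlamBall {α : Type*} {l y : List α} (b : α) (h : y ∈ unitUlamBall l) :
    b :: y ∈ unitUlamBall (b :: l) := by
  obtain ⟨hp, z, hz₁, hz₂, hz⟩ := h
  exact ⟨hp.cons b, b :: z, hz₁.cons_cons b, hz₂.cons_cons b, by simpa using hz⟩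

theorem cons_erase_mem_unitUlamBall {α : Type*} [DecidableEq α] {l : List α} {a : α} (h : a ∈ l) :
    a :: l.erase a ∈ unitUlamBall l :=
  ⟨(List.perm_cons_erase h).symm, l.erase a, List.erase_sublist, List.sublist_cons_self _ _, by
    rw [List.length_erase_of_mem h]; omega⟩

theorem exists_finset_insertions {α : Type*} (b : α) (l : List α) (hb : b ∉ l) :
    ∃ F : Finset (List α), F.card = l.length ∧
      ∀ y ∈ F, y.Perm (b :: l) ∧ l.Sublist y ∧ y.head? ≠ some b := by
  classical
  induction l with
  | nil => exact ⟨∅, by simp⟩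
  | cons c l ih =>
    simp only [List.mem_cons, not_or] at hb
    obtain ⟨F, hF, h⟩ := ih hb.2
    refine ⟨insert (c :: b :: l) (F.image (List.cons c)), ?_, ?_⟩
    · rw [Finset.card_insert_of_notMem, Finset.card_image_of_injective _ List.cons_injective, hF,
        List.length_cons]
      simp only [Finset.mem_image, List.cons.injEq, true_and, exists_eq_right]
      intro hm
      exact (h _ hm).2.2 rfl
    · intro y hy
      rw [Finset.mem_insert, Finset.mem_image] at hy
      rcases hy with rfl | ⟨y, hy, rfl⟩
      · exact ⟨List.Perm.swap _ _ _, (List.sublist_cons_self _ _).cons_cons c,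
          by simpa using Ne.symm hb.1⟩
      · exact ⟨((h y hy).1.cons c).trans (List.Perm.swap _ _ _), (h y hy).2.1.cons_cons c,
          by simpa using Ne.symm hb.1⟩

theorem exists_finset_subset_unitUlamBall {α : Type*} [DecidableEq α] (l : List α) (hl : l ≠ []) :
    ∃ F : Finset (List α), (∀ y ∈ F, y ∈ unitUlamBall l) ∧
      1 + (l.length - 1) * (l.toFinset.card - 1) ≤ F.card := by
  induction l with
  | nil => exact absurd rfl hl
  | cons b l ih =>
    rcases l with _ | ⟨c, l⟩
    · exact ⟨{[b]}, by simp [unitUlamBall], by simp⟩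
    obtain ⟨F, hF, hcard⟩ := ih (by simp)
    set t := c :: l with ht
    set G : Finset (List α) := (t.toFinset.erase b).image fun a => a :: b :: t.erase a with hG
    have hGcard : G.card = (t.toFinset.erase b).card :=
      Finset.card_image_of_injective _ fun a a' h => (List.cons.inj h).1
    have hGmem : ∀ y ∈ G, y ∈ unitUlamBall (b :: t) := by
      intro y hy
      obtain ⟨a, ha, rfl⟩ := Finset.mem_image.1 hy
      rw [Finset.mem_erase, List.mem_toFinset] at ha
      have := cons_erase_mem_unitUlamBall (List.mem_cons_of_mem b ha.2)
      rwa [List.erase_cons_tail (by simpa using Ne.symm ha.1)] at this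
    have hdisj : Disjoint (F.image (List.cons b)) G := by
      rw [Finset.disjoint_left]
      intro y hy hy'
      obtain ⟨u, -, rfl⟩ := Finset.mem_image.1 hy
      obtain ⟨a, ha, h⟩ := Finset.mem_image.1 hy'
      exact (Finset.mem_erase.1 ha).1 (List.cons.inj h).1
    have hFcard : (F.image (List.cons b)).card = F.card :=
      Finset.card_image_of_injective _ List.cons_injective
    have hFmem : ∀ y ∈ F.image (List.cons b), y ∈ unitUlamBall (b :: t) := by
      intro y hy
      obtain ⟨u, hu, rfl⟩ := Finset.mem_image.1 hy
      exact cons_mem_unitUlamBall b (hF u hu)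
    have hlen : t.length = l.length + 1 := rfl
    obtain ⟨d, hd⟩ : ∃ d, t.toFinset.card = d + 1 :=
      Nat.exists_eq_succ_of_ne_zero (Finset.card_ne_zero.2 ⟨c, by simp [ht]⟩)
    by_cases hb : b ∈ t
    · refine ⟨F.image (List.cons b) ∪ G, ?_, ?_⟩
      · intro y hy
        exact (Finset.mem_union.1 hy).elim (hFmem y) (hGmem y)
      · rw [Finset.card_union_of_disjoint hdisj, hFcard, hGcard,
          Finset.card_erase_of_mem (List.mem_toFinset.2 hb), List.toFinset_cons,
          Finset.insert_eq_of_mem (List.mem_toFinset.2 hb)]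
        rw [List.length_cons]
        rw [hlen, hd] at hcard
        rw [hlen, hd]
        simp only [Nat.add_sub_cancel] at hcard ⊢
        linarith
    · have hbc : b ≠ c := fun h => hb (h ▸ List.mem_cons_self)
      obtain ⟨E, hE, hEmem⟩ := exists_finset_insertions b l fun h => hb (List.mem_cons_of_mem _ h)
      have hEcard : (E.image (List.cons c)).card = E.card :=
        Finset.card_image_of_injective _ List.cons_injective
      have hdisj' : Disjoint (F.image (List.cons b) ∪ G) (E.image (List.cons c)) := by
        rw [Finset.disjoint_right]
        intro y hy hy'
        obtain ⟨u, hu, rfl⟩ := Finset.mem_image.1 hy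
        rcases Finset.mem_union.1 hy' with hy' | hy'
        · obtain ⟨v, -, h⟩ := Finset.mem_image.1 hy'
          exact hbc (List.cons.inj h).1
        · obtain ⟨a, -, h⟩ := Finset.mem_image.1 hy'
          refine (hEmem u hu).2.2 ?_
          rw [← (List.cons.inj h).2]
          rfl
      refine ⟨F.image (List.cons b) ∪ G ∪ E.image (List.cons c), ?_, ?_⟩
      · intro y hy
        rcases Finset.mem_union.1 hy with hy | hy
        · exact (Finset.mem_union.1 hy).elim (hFmem y) (hGmem y)
        · obtain ⟨u, hu, rfl⟩ := Finset.mem_image.1 hy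
          obtain ⟨hp, hs, -⟩ := hEmem u hu
          exact ⟨(hp.cons c).trans (List.Perm.swap _ _ _), t, List.sublist_cons_self _ _,
            hs.cons_cons c, by simp⟩
      · have hb' : b ∉ t.toFinset := fun h => hb (List.mem_toFinset.1 h)
        rw [Finset.card_union_of_disjoint hdisj', Finset.card_union_of_disjoint hdisj, hFcard,
          hGcard, hEcard, hE, Finset.erase_eq_of_notMem hb', List.toFinset_cons,
          Finset.card_insert_of_notMem hb', List.length_cons]
        rw [hlen, hd] at hcard
        rw [hlen, hd]
        simp only [Nat.add_sub_cancel] at hcard ⊢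
        linarith

theorem mdist_le_two_of_mem_unitUlamBall {n : ℕ} {α : Type*} {x y : Fin n → α} {z : List α}
    (hx : z ∈ unitUlamBall (List.ofFn x)) (hy : z ∈ unitUlamBall (List.ofFn y)) :
    mdist x y ≤ 2 := by
  obtain ⟨hp, u, hu, huz, hul⟩ := hx
  obtain ⟨-, v, hv, hvz, hvl⟩ := hy
  obtain ⟨w, hwu, hwv, hw⟩ := huz.exists_common_sublist hvz
  have hz : z.length = n := by simpa using hp.length_eq
  have hle : w.length ≤ lcsLen (List.ofFn x) (List.ofFn y) := by
    refine le_csSup ⟨n, ?_⟩ ⟨w, rfl, hwu.trans hu, hwv.trans hv⟩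
    rintro k ⟨s, rfl, hs, -⟩
    simpa using hs.length_le
  rw [List.length_ofFn] at hul hvl
  unfold mdist
  omega

theorem exists_comp_perm_of_ofFn_perm {n : ℕ} {α : Type*} [LinearOrder α] {x y : Fin n → α}
    (h : (List.ofFn y).Perm (List.ofFn x)) : ∃ σ : Equiv.Perm (Fin n), y = x ∘ σ := by
  have key : y ∘ Tuple.sort y = x ∘ Tuple.sort x := by
    refine List.ofFn_injective (List.Perm.eq_of_pairwise' (r := (· ≤ ·))
      (Tuple.monotone_sort y).sortedLE_ofFn.pairwise (Tuple.monotone_sort x).sortedLE_ofFn.pairwise ?_)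
    exact ((Tuple.sort y).ofFn_comp_perm y).trans (h.trans ((Tuple.sort x).ofFn_comp_perm x).symm)
  refine ⟨(Tuple.sort y).symm.trans (Tuple.sort x), funext fun i => ?_⟩
  simpa using congrFun key ((Tuple.sort y).symm i)

theorem mem_Mset_of_ofFn_perm {n r : ℕ} {x y : Fin n → ℕ} (hx : x ∈ Mset n r)
    (h : (List.ofFn y).Perm (List.ofFn x)) : y ∈ Mset n r := by
  obtain ⟨τ, rfl⟩ := hx
  obtain ⟨σ, rfl⟩ := exists_comp_perm_of_ofFn_perm h
  exact ⟨σ.trans τ, rfl⟩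

theorem image_mreg {k r : ℕ} (hr : 0 < r) (σ : Equiv.Perm (Fin (r * k))) :
    Finset.univ.image (mreg r σ) = Finset.Icc 1 k := by
  ext j
  simp only [Finset.mem_image, Finset.mem_univ, true_and, Finset.mem_Icc, mreg]
  constructor
  · rintro ⟨i, rfl⟩
    exact ⟨Nat.succ_pos _, Nat.div_lt_of_lt_mul (σ i).isLt⟩
  · rintro ⟨h₁, h₂⟩
    have hlt : r * (j - 1) < r * k := Nat.mul_lt_mul_of_pos_left (by omega) hr
    refine ⟨σ.symm ⟨r * (j - 1), hlt⟩, ?_⟩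
    simp only [Equiv.apply_symm_apply, Nat.mul_div_cancel_left _ hr]
    omega

theorem card_mreg_fiber {k r : ℕ} (hr : 0 < r) {j : ℕ} (hj : j ∈ Finset.Icc 1 k) :
    Fintype.card {i : Fin (r * k) // mreg r 1 i = j} = r := by
  rw [Finset.mem_Icc] at hj
  obtain ⟨j, rfl⟩ : ∃ m, j = m + 1 := ⟨j - 1, by omega⟩
  have hlt : r * j + r ≤ r * k := by
    rw [← Nat.mul_succ]; exact Nat.mul_le_mul_left r hj.2
  have hval : ∀ a : Fin r, r * j + a < r * k := fun a => by omega
  let f : Fin r → {i : Fin (r * k) // mreg r 1 i = j + 1} := fun a =>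
    ⟨⟨r * j + a, hval a⟩, by
      simp [mreg, Nat.mul_add_div hr, Nat.div_eq_of_lt a.isLt]⟩
  have hf : Function.Bijective f := by
    constructor
    · intro a b h
      have := congrArg (fun i => (i.1 : ℕ)) h
      simp only [f] at this
      exact Fin.ext (by omega)
    · rintro ⟨i, hi⟩
      simp only [mreg, Equiv.Perm.coe_one, id_eq, Nat.add_right_cancel_iff] at hi
      refine ⟨⟨i % r, Nat.mod_lt _ hr⟩, Subtype.ext (Fin.ext ?_)⟩
      simp only [f, ← hi, Nat.div_add_mod]
  rw [← Fintype.card_of_bijective hf, Fintype.card_fin]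

theorem card_Mset_mul {k r : ℕ} (hr : 0 < r) :
    (Mset (r * k) r).ncard * r.factorial ^ k = (r * k).factorial := by
  classical
  have hM : Mset (r * k) r = ((Finset.univ.image (mreg (n := r * k) r) : Finset _) : Set _) := by
    ext m; simp [Mset, eq_comm]
  have hfib : ∀ m ∈ Finset.univ.image (mreg (n := r * k) r),
      (Finset.univ.filter fun σ => mreg (n := r * k) r σ = m).card = r.factorial ^ k := by
    intro m hm
    obtain ⟨τ, -, rfl⟩ := Finset.mem_image.1 hm
    rw [← Fintype.card_subtype]
    have hstab := DomMulAct.stabilizer_card' (mreg (n := r * k) r 1)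
    rw [image_mreg hr, Finset.prod_congr rfl fun j hj => by rw [card_mreg_fiber hr hj],
      Finset.prod_const, Nat.card_Icc, Nat.add_sub_cancel] at hstab
    rw [← hstab]
    refine Fintype.card_congr ((Equiv.mulRight τ⁻¹).subtypeEquiv fun σ => ?_)
    simp only [funext_iff, mreg, Function.comp]
    constructor
    · intro h i
      simpa using h (τ⁻¹ i)
    · intro h i
      simpa using h (τ i)
  have := Finset.card_eq_sum_card_image (mreg (n := r * k) r) Finset.univ
  rw [Finset.sum_congr rfl hfib, Finset.sum_const, Finset.card_univ, Fintype.card_perm,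
    Fintype.card_fin, smul_eq_mul] at this
  rw [hM, Set.ncard_coe_finset, this]

/-- If `C ⊆ M_r(S_n)` is a single-error correcting multipermutation code
(any two distinct codewords at `r`-regular Ulam distance ≥ 3), then
`|C| ≤ n! / ((r!)^{n/r} · (1 + (n-1)(n/r - 1)))`. -/
theorem single_error_code_card_upper_bound (n r : ℕ) (hn : 0 < n) (hr : 0 < r)
    (hdvd : r ∣ n) (C : Set (Fin n → ℕ)) (hsub : C ⊆ Mset n r)
    (hcode : ∀ x ∈ C, ∀ y ∈ C, x ≠ y → 3 ≤ mdist x y) :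
    (C.ncard : ℝ) ≤ (n.factorial : ℝ) /
      ((r.factorial : ℝ) ^ (n / r) * ((1 + (n - 1) * (n / r - 1) : ℕ) : ℝ)) := by
  classical
  obtain ⟨k, rfl⟩ := hdvd
  rw [Nat.mul_div_cancel_left k hr]
  set B := 1 + (r * k - 1) * (k - 1) with hB
  have hfin : (Mset (r * k) r).Finite := by
    have : Mset (r * k) r = Set.range (mreg r) := by ext m; simp [Mset, eq_comm]
    rw [this]
    exact Set.finite_range _
  have hball : ∀ x ∈ Mset (r * k) r, ∃ F : Finset (List ℕ),
      (∀ y ∈ F, y ∈ unitUlamBall (List.ofFn x)) ∧ B ≤ F.card := by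
    intro x hx
    obtain ⟨σ, rfl⟩ := hx
    have hne : List.ofFn (mreg r σ) ≠ [] := by
      rw [← List.length_pos_iff]; simpa using hn
    have hcard : (List.ofFn (mreg r σ)).toFinset.card = k := by
      have : (List.ofFn (mreg r σ)).toFinset = Finset.univ.image (mreg r σ) := by
        ext j; simp [List.mem_ofFn]
      rw [this, image_mreg hr, Nat.card_Icc, Nat.add_sub_cancel]
    simpa [hcard] using exists_finset_subset_unitUlamBall _ hne
  choose! F hF hFcard using hball
  have hCfin : C.Finite := hfin.subset hsub
  have hdisj : ∀ x ∈ hCfin.toFinset, ∀ y ∈ hCfin.toFinset, x ≠ y → Disjoint (F x) (F y) := by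
    intro x hx y hy hxy
    rw [Set.Finite.mem_toFinset] at hx hy
    rw [Finset.disjoint_left]
    intro z hzx hzy
    have h₁ := hcode x hx y hy hxy
    have h₂ := mdist_le_two_of_mem_unitUlamBall (hF x (hsub hx) z hzx) (hF y (hsub hy) z hzy)
    omega
  have hsubset : hCfin.toFinset.biUnion F ⊆ hfin.toFinset.image List.ofFn := by
    intro z hz
    obtain ⟨x, hx, hzx⟩ := Finset.mem_biUnion.1 hz
    rw [Set.Finite.mem_toFinset] at hx
    have hp := (hF x (hsub hx) z hzx).1
    have hlen : z.length = r * k := by simpa using hp.length_eq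
    obtain ⟨y, rfl⟩ : ∃ y : Fin (r * k) → ℕ, List.ofFn y = z := by
      clear_value B
      rw [← hlen]
      exact ⟨z.get, List.ofFn_get z⟩
    exact Finset.mem_image_of_mem _ (hfin.mem_toFinset.2 (mem_Mset_of_ofFn_perm (hsub hx) hp))
  have hpack : C.ncard * B ≤ (Mset (r * k) r).ncard := by
    rw [Set.ncard_eq_toFinset_card C hCfin, Set.ncard_eq_toFinset_card _ hfin]
    calc hCfin.toFinset.card * B ≤ ∑ x ∈ hCfin.toFinset, (F x).card := by
          rw [← smul_eq_mul]
          exact Finset.card_nsmul_le_sum _ _ _ fun x hx =>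
            hFcard x (hsub (hCfin.mem_toFinset.1 hx))
      _ = (hCfin.toFinset.biUnion F).card := (Finset.card_biUnion hdisj).symm
      _ ≤ _ := (Finset.card_le_card hsubset).trans Finset.card_image_le
  have hBpos : 0 < B := by omega
  rw [le_div_iff₀ (by positivity)]
  have key : C.ncard * (r.factorial ^ k * B) ≤ (r * k).factorial := by
    rw [← card_Mset_mul hr]
    calc _ = C.ncard * B * r.factorial ^ k := by ring
      _ ≤ _ := Nat.mul_le_mul_right _ hpack
  exact_mod_cast key
end

section
/- Let n and r be positive integers with r dividing n and n/r ≠ 2. If C ⊆ M_r(S_n) is a perfect single-error correcting r-regular multipermutation code (a perfect 1-error correcting MPC(n,r)), then n! / ((r!)^{n/r} · (1 + (n−1)² − (r−1)n)) ≤ |C|. -/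
theorem exists_append_cons_of_lt {α : Type*} {l : List α} {i : ℕ} (hi : i < l.length) :
    ∃ s a t, l = s ++ a :: t ∧ s.length = i :=
  ⟨l.take i, l[i], l.drop (i + 1), by simp, by simp; omega⟩

theorem exists_append_cons_of_sublist {α : Type*} {z l : List α} (h : z.Sublist l)
    (hlen : l.length = z.length + 1) : ∃ s a t, l = s ++ a :: t ∧ z = s ++ t := by
  induction h with
  | slnil => simp at hlen
  | @cons z l a h ih =>
    exact ⟨[], a, l, rfl, h.eq_of_length (by simpa using hlen.symm)⟩
  | @cons_cons z l a h ih =>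
    obtain ⟨s, b, t, rfl, rfl⟩ := ih (by simpa using hlen)
    exact ⟨a :: s, b, t, rfl, rfl⟩

/-- All lists obtained by inserting the letter `a` somewhere into a list. -/
def insertions {α : Type*} [DecidableEq α] (a : α) : List α → Finset (List α)
  | [] => {[a]}
  | b :: l => insert (a :: b :: l) ((insertions a l).image (List.cons b))

section Insertions

variable {α : Type*} [DecidableEq α]

theorem append_cons_mem_insertions (a : α) (s t : List α) :
    s ++ a :: t ∈ insertions a (s ++ t) := by
  induction s with
  | nil => cases t <;> simp [insertions]
  | cons b s ih => simp [insertions, ih]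

theorem card_insertions_add_count_le (a : α) (l : List α) :
    (insertions a l).card + l.count a ≤ l.length + 1 := by
  induction l with
  | nil => simp [insertions]
  | cons b l ih =>
    have hcard : ((insertions a l).image (List.cons b)).card ≤ (insertions a l).card :=
      Finset.card_image_le
    by_cases hab : b = a
    · subst hab
      have hmem : b :: b :: l ∈ (insertions b l).image (List.cons b) :=
        Finset.mem_image_of_mem _ (append_cons_mem_insertions b [] l)
      rw [insertions, Finset.insert_eq_of_mem hmem, List.count_cons_self, List.length_cons]
      omega
    · have := Finset.card_insert_le (a :: b :: l) ((insertions a l).image (List.cons b))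
      rw [insertions, List.count_cons_of_ne hab, List.length_cons]
      omega

theorem exists_mem_insertions_ne {a d : α} {l : List α} (hd : d ∈ l) (hda : d ≠ a)
    (c : List α) : ∃ x ∈ insertions a l, x ≠ c := by
  obtain ⟨s, t, rfl⟩ := List.append_of_mem hd
  by_cases h : s ++ a :: d :: t = c
  · refine ⟨s ++ d :: a :: t, by simpa using append_cons_mem_insertions a (s ++ [d]) t, ?_⟩
    rintro rfl
    simp [hda.symm] at h
  · exact ⟨_, append_cons_mem_insertions a s (d :: t), h⟩

/-- Lists other than `l` obtained by moving the letter of `l` at position `i`. -/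
def translocations (l : List α) (i : ℕ) : Finset (List α) :=
  (l[i]?.elim ∅ fun a => insertions a (l.eraseIdx i)).erase l

theorem translocations_append_cons (s t : List α) (a : α) :
    translocations (s ++ a :: t) s.length = (insertions a (s ++ t)).erase (s ++ a :: t) := by
  simp [translocations, List.eraseIdx_append_of_length_le]

theorem card_translocations_le {c : List α} {r i : ℕ} (hr : ∀ a ∈ c, c.count a = r)
    (hi : i < c.length) : (translocations c i).card ≤ c.length - r := by
  obtain ⟨s, a, t, rfl, rfl⟩ := exists_append_cons_of_lt hi
  have hc := hr a (by simp)
  rw [translocations_append_cons, Finset.card_erase_of_mem (append_cons_mem_insertions a s t)]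
  have := card_insertions_add_count_le a (s ++ t)
  simp only [List.count_append, List.count_cons_self, List.length_append,
    List.length_cons] at *
  omega

theorem translocations_inter_succ_nonempty {c : List α} {i : ℕ}
    (hne : ∀ a, ∃ d ∈ c, d ≠ a) (hi : i + 1 < c.length) :
    (translocations c i ∩ translocations c (i + 1)).Nonempty := by
  obtain ⟨s, a, t, rfl, rfl⟩ := exists_append_cons_of_lt (Nat.lt_of_succ_lt hi)
  cases t with
  | nil => simp at hi
  | cons b t =>
    have hsucc := translocations_append_cons (s ++ [a]) t b
    simp only [List.append_assoc, List.singleton_append, List.length_append,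
      List.length_singleton] at hsucc
    rw [translocations_append_cons, hsucc]
    by_cases hab : a = b
    · subst hab
      obtain ⟨d, hd, hda⟩ := hne a
      obtain ⟨x, hx, hxc⟩ := exists_mem_insertions_ne (l := s ++ a :: t)
        (by simpa [hda] using hd) hda (s ++ a :: a :: t)
      exact ⟨x, by simp [hx, hxc]⟩
    · refine ⟨s ++ b :: a :: t, ?_⟩
      have h₁ := append_cons_mem_insertions a (s ++ [b]) t
      have h₂ := append_cons_mem_insertions b s (a :: t)
      simp only [List.append_assoc, List.singleton_append] at h₁
      simp [h₁, h₂, Ne.symm hab]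

theorem card_biUnion_range_succ_add_le {β : Type*} [DecidableEq β] (A : ℕ → Finset β)
    (s n : ℕ) (hcard : ∀ i ≤ n, (A i).card ≤ s)
    (hinter : ∀ i < n, (A i ∩ A (i + 1)).Nonempty) :
    ((Finset.range (n + 1)).biUnion A).card + n ≤ (n + 1) * s := by
  induction n with
  | zero => simpa using hcard 0 le_rfl
  | succ n ih =>
    have ih := ih (fun i hi => hcard i (by omega)) (fun i hi => hinter i (by omega))
    have hpos : 0 < (A (n + 1) ∩ (Finset.range (n + 1)).biUnion A).card := by
      obtain ⟨x, hx⟩ := hinter n (by omega)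
      rw [Finset.mem_inter] at hx
      exact Finset.card_pos.2 ⟨x, Finset.mem_inter.2
        ⟨hx.2, Finset.mem_biUnion.2 ⟨n, by simp, hx.1⟩⟩⟩
    have hunion := Finset.card_union_add_card_inter (A (n + 1)) ((Finset.range (n + 1)).biUnion A)
    have hlast := hcard (n + 1) le_rfl
    rw [Finset.range_add_one, Finset.biUnion_insert]
    linarith

theorem mem_translocations_of_common_sublist {z c x : List α} (hzc : z.Sublist c)
    (hzx : z.Sublist x) (hperm : x.Perm c) (hlen : c.length ≤ z.length + 1) (hxc : x ≠ c) :
    ∃ i < c.length, x ∈ translocations c i := by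
  have hx := hperm.length_eq
  have hle := hzc.length_le
  have hz : c.length = z.length + 1 := by
    by_contra hz
    exact hxc ((hzx.eq_of_length (by omega)).symm.trans (hzc.eq_of_length (by omega)))
  obtain ⟨s, a, t, rfl, rfl⟩ := exists_append_cons_of_sublist hzc hz
  obtain ⟨s', b, t', rfl, hst⟩ := exists_append_cons_of_sublist hzx (by omega)
  obtain rfl : b = a := by
    have h₁ : (b :: (s' ++ t')).Perm (a :: (s' ++ t')) := by
      refine List.perm_middle.symm.trans (hperm.trans (List.perm_middle.trans ?_))
      rw [hst]
    have h₂ := h₁.count_eq b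
    by_contra hba
    rw [List.count_cons_self, List.count_cons_of_ne (Ne.symm hba)] at h₂
    omega
  refine ⟨s.length, by simp, ?_⟩
  rw [translocations_append_cons, Finset.mem_erase, hst]
  exact ⟨hxc, append_cons_mem_insertions _ _ _⟩

end Insertions

theorem exists_common_sublist_length_eq_lcsLen {α : Type*} (x y : List α) :
    ∃ z : List α, z.length = lcsLen x y ∧ z.Sublist x ∧ z.Sublist y := by
  have hne : {k | ∃ z : List α, z.length = k ∧ z.Sublist x ∧ z.Sublist y}.Nonempty :=
    ⟨0, [], by simp⟩
  refine Nat.sSup_mem hne ⟨x.length, ?_⟩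
  rintro k ⟨z, rfl, hz, -⟩
  exact hz.length_le

theorem card_filter_div_eq {n r j : ℕ} (hr : 0 < r) (hj : j < n / r) :
    (Finset.univ.filter fun i : Fin n => (i : ℕ) / r = j).card = r := by
  have hle : (j + 1) * r ≤ n := (Nat.mul_le_mul_right r hj).trans (Nat.div_mul_le_self n r)
  have himage : (Finset.univ.filter fun i : Fin n => (i : ℕ) / r = j).map Fin.valEmbedding =
      Finset.Ico (j * r) ((j + 1) * r) := by
    ext i
    simp only [Finset.mem_map, Finset.mem_filter, Finset.mem_univ, true_and,
      Fin.valEmbedding_apply, Finset.mem_Ico, Nat.div_eq_iff hr]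
    constructor
    · rintro ⟨i, hi, rfl⟩
      rw [add_mul]; omega
    · rintro ⟨h₁, h₂⟩
      exact ⟨⟨i, by omega⟩, by rw [add_mul] at h₂; simp only; omega, rfl⟩
  rw [← Finset.card_map Fin.valEmbedding, himage, Nat.card_Ico, add_mul]
  omega

theorem mreg_perm {n r : ℕ} (σ : Equiv.Perm (Fin n)) :
    (List.ofFn (mreg r σ)).Perm (List.ofFn (mreg r (1 : Equiv.Perm (Fin n)))) :=
  Equiv.Perm.ofFn_comp_perm σ (mreg r (1 : Equiv.Perm (Fin n)))

theorem count_ofFn_mreg {n r : ℕ} (hr : 0 < r) (hdvd : r ∣ n) (σ : Equiv.Perm (Fin n))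
    {a : ℕ} (ha : a ∈ List.ofFn (mreg r σ)) : (List.ofFn (mreg r σ)).count a = r := by
  rw [(mreg_perm σ).mem_iff, List.mem_ofFn] at ha
  obtain ⟨i, rfl⟩ := ha
  rw [(mreg_perm σ).count_eq, ← Multiset.coe_count, ← Fin.univ_val_map, Multiset.count_map]
  refine Eq.trans ?_ (card_filter_div_eq hr
    (Nat.div_lt_div_of_lt_of_dvd hdvd i.isLt : (i : ℕ) / r < n / r))
  simp [mreg, Finset.card_def, Finset.filter_val, eq_comm]

/-- The multipermutations as a finset. -/
def multipermutations (n r : ℕ) : Finset (Fin n → ℕ) :=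
  Finset.univ.image (mreg r : Equiv.Perm (Fin n) → Fin n → ℕ)

theorem mem_multipermutations {n r : ℕ} {m : Fin n → ℕ} :
    m ∈ multipermutations n r ↔ m ∈ Mset n r := by
  simp [multipermutations, Mset, eq_comm]

theorem factorial_le_card_multipermutations {n r : ℕ} (hr : 0 < r) (hdvd : r ∣ n) :
    n.factorial ≤ (r.factorial) ^ (n / r) * (multipermutations n r).card := by
  have hcard : n.factorial = (Finset.univ : Finset (Equiv.Perm (Fin n))).card := by
    rw [Finset.card_univ, Fintype.card_perm, Fintype.card_fin]
  rw [hcard]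
  refine Finset.card_le_mul_card_image Finset.univ _ fun m hm => ?_
  obtain ⟨σ, -, rfl⟩ := Finset.mem_image.1 hm
  let f : Fin n → Fin (n / r) := fun i => ⟨i / r, Nat.div_lt_div_of_lt_of_dvd hdvd i.isLt⟩
  have hstab := DomMulAct.stabilizer_card f
  have hfib (j : Fin (n / r)) : Fintype.card {i // f i = j} = r := by
    rw [Fintype.card_subtype]
    simpa [f, Fin.ext_iff] using card_filter_div_eq hr j.isLt
  simp only [hfib, Finset.prod_const, Finset.card_univ, Fintype.card_fin] at hstab
  rw [← hstab, Fintype.card_subtype]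
  refine Finset.card_le_card_of_injOn (fun τ => τ * σ⁻¹) ?_ fun _ _ _ _ h => mul_right_cancel h
  intro τ hτ
  simp only [Finset.coe_filter, Finset.mem_univ, true_and, Set.mem_ofPred_eq] at hτ ⊢
  funext i
  have := congrFun hτ (σ⁻¹ i)
  simpa [mreg, f, Fin.ext_iff] using this

theorem card_unit_sphere_add_le {n r : ℕ} (hr : 0 < r) (hdvd : r ∣ n) (hrn : r < n)
    {c : Fin n → ℕ} (hc : c ∈ Mset n r) :
    ((multipermutations n r).filter fun m => mdist c m ≤ 1).card + (n - 1) ≤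
      1 + n * (n - r) := by
  obtain ⟨σ, rfl⟩ := hc
  set l := List.ofFn (mreg r σ) with hl
  have hlen : l.length = n := List.length_ofFn
  have hcount : ∀ a ∈ l, l.count a = r := fun a ha => count_ofFn_mreg hr hdvd σ ha
  have hne (a : ℕ) : ∃ d ∈ l, d ≠ a := by
    by_contra! h
    have h₁ : l.count a = l.length := List.count_eq_length.2 fun d hd => (h d hd).symm
    have h₂ : a ∈ l := by rw [← List.count_pos_iff]; omega
    have := hcount a h₂
    omega
  have hunion := card_biUnion_range_succ_add_le (translocations l) (n - r) (n - 1)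
    (fun i hi => by simpa [hlen] using card_translocations_le hcount (i := i) (by omega))
    (fun i hi => translocations_inter_succ_nonempty hne (by omega))
  rw [Nat.sub_add_cancel (by omega)] at hunion
  have hsphere : ((multipermutations n r).filter fun m => mdist (mreg r σ) m ≤ 1).card ≤
      (insert l ((Finset.range n).biUnion (translocations l))).card := by
    refine Finset.card_le_card_of_injOn List.ofFn ?_ List.ofFn_injective.injOn
    intro m hm
    simp only [Finset.coe_filter, Set.mem_ofPred_eq, mem_multipermutations] at hm
    obtain ⟨⟨τ, rfl⟩, hd⟩ := hm
    obtain ⟨z, hz, hzl, hzm⟩ := exists_common_sublist_length_eq_lcsLen l (List.ofFn (mreg r τ))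
    rw [mdist, ← hl, ← hz] at hd
    rw [Finset.mem_coe, Finset.mem_insert, or_iff_not_imp_left]
    intro hml
    obtain ⟨i, hi, hmem⟩ := mem_translocations_of_common_sublist hzl hzm
      ((mreg_perm τ).trans (mreg_perm σ).symm) (by omega) hml
    exact Finset.mem_biUnion.2 ⟨i, by simpa [hlen] using hi, hmem⟩
  have := Finset.card_insert_le l ((Finset.range n).biUnion (translocations l))
  omega

theorem card_unit_sphere_le {n r : ℕ} (hr : 0 < r) (hdvd : r ∣ n) (hrn : r < n)
    {c : Fin n → ℕ} (hc : c ∈ Mset n r) :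
    ((multipermutations n r).filter fun m => mdist c m ≤ 1).card ≤
      1 + (n - 1) ^ 2 - (r - 1) * n := by
  have h := card_unit_sphere_add_le hr hdvd hrn hc
  refine Nat.le_sub_of_add_le ?_
  generalize Finset.card _ = k at *
  obtain ⟨s, rfl⟩ := Nat.exists_eq_add_of_lt hrn
  obtain ⟨q, rfl⟩ := Nat.exists_eq_add_of_lt hr
  rw [show 0 + q + 1 + s + 1 - (0 + q + 1) = s + 1 by omega] at h
  simp only [zero_add, Nat.add_sub_cancel] at *
  nlinarith

/-- If `n/r ≠ 2` and `C ⊆ M_r(S_n)` is a perfect single-error correcting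
multipermutation code, then `n! / ((r!)^{n/r} · (1 + (n-1)² - (r-1)n)) ≤ |C|`. -/
theorem perfect_single_error_code_card_lower_bound (n r : ℕ) (hn : 0 < n) (hr : 0 < r)
    (hdvd : r ∣ n) (hnr : n / r ≠ 2) (C : Set (Fin n → ℕ)) (hsub : C ⊆ Mset n r)
    (hperfect : ∀ m ∈ Mset n r, ∃! c, c ∈ C ∧ mdist c m ≤ 1) :
    (n.factorial : ℝ) /
        ((r.factorial : ℝ) ^ (n / r) * ((1 + (n - 1) ^ 2 - (r - 1) * n : ℕ) : ℝ)) ≤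
      (C.ncard : ℝ) := by
  have hfin : (Mset n r).Finite :=
    (multipermutations n r).finite_toSet.subset fun m hm => mem_multipermutations.2 hm
  have hCfin := hfin.subset hsub
  rcases (Nat.le_of_dvd hn hdvd).eq_or_lt with rfl | hrn
  · rcases Nat.lt_or_ge 1 r with h | h
    · have hzero : 1 + (r - 1) ^ 2 - (r - 1) * r = 0 := by
        obtain ⟨s, rfl⟩ := Nat.exists_eq_add_of_lt h
        simp only [Nat.add_sub_cancel]
        rw [Nat.sub_eq_zero_iff_le]
        nlinarith
      simp [hzero]
    · obtain rfl : r = 1 := by omega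
      obtain ⟨c, ⟨hc, -⟩, -⟩ := hperfect _ ⟨1, rfl⟩
      have : 0 < C.ncard := (Set.ncard_pos hCfin).2 ⟨c, hc⟩
      simpa [Nat.one_le_iff_ne_zero, Nat.pos_iff_ne_zero] using this
  set B := 1 + (n - 1) ^ 2 - (r - 1) * n with hB
  have hcover : multipermutations n r ⊆ hCfin.toFinset.biUnion fun c =>
      (multipermutations n r).filter fun m => mdist c m ≤ 1 := by
    intro m hm
    obtain ⟨c, ⟨hc, hd⟩, -⟩ := hperfect m (mem_multipermutations.1 hm)
    exact Finset.mem_biUnion.2 ⟨c, hCfin.mem_toFinset.2 hc, Finset.mem_filter.2 ⟨hm, hd⟩⟩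
  have hcard : (multipermutations n r).card ≤ C.ncard * B := by
    rw [Set.ncard_eq_toFinset_card C hCfin]
    exact (Finset.card_le_card hcover).trans <| Finset.card_biUnion_le_card_mul _ _ _ fun c hc =>
      card_unit_sphere_le hr hdvd hrn (hsub (hCfin.mem_toFinset.1 hc))
  have hmain : n.factorial ≤ C.ncard * (r.factorial ^ (n / r) * B) :=
    (factorial_le_card_multipermutations hr hdvd).trans <|
      (Nat.mul_le_mul_left _ hcard).trans_eq (by ring)
  refine div_le_of_le_mul₀ (by positivity) (by positivity) ?_
  exact_mod_cast hmain
end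

section
/- Let n and r be positive integers with r dividing n and n/r ≠ 2, let d be a positive integer, and let C ⊆ M_r(S_n) be a code of maximal cardinality among all codes in M_r(S_n) whose minimum r-regular Ulam distance between distinct codewords equals d. Then n! / ((r!)^{n/r} · (1 + (n−1)² − (r−1)n)^{d−1}) ≤ |C|. -/
/-- The index map of the translocation that moves the entry at position `i` to position `j`. -/
def moveIdx (i j k : ℕ) : ℕ :=
  if k = j then i
  else if i ≤ k ∧ k < j then k + 1
  else if j < k ∧ k ≤ i then k - 1
  else k

theorem comp_moveIdx_self (X : ℕ → ℕ) (i : ℕ) : X ∘ moveIdx i i = X := by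
  funext k
  simp only [Function.comp, moveIdx]
  grind

theorem comp_moveIdx_target_pred (X : ℕ → ℕ) {i j : ℕ} (hij : i < j) (h : X i = X j) :
    X ∘ moveIdx i j = X ∘ moveIdx i (j - 1) := by
  funext k
  simp only [Function.comp, moveIdx]
  grind

theorem comp_moveIdx_target_succ (X : ℕ → ℕ) {i j : ℕ} (hij : j < i) (h : X i = X j) :
    X ∘ moveIdx i j = X ∘ moveIdx i (j + 1) := by
  funext k
  simp only [Function.comp, moveIdx]
  grind

theorem comp_moveIdx_source_pred (X : ℕ → ℕ) {i j : ℕ} (hi : i ≠ 0) (h : X (i - 1) = X i) :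
    X ∘ moveIdx i j = X ∘ moveIdx (i - 1) j := by
  funext k
  simp only [Function.comp, moveIdx]
  grind

theorem moveIdx_succ_swap (j : ℕ) : moveIdx (j + 1) j = moveIdx j (j + 1) := by
  funext k
  simp only [moveIdx]
  grind

/-- Targets `j` of the canonical translocations of the entry at position `i`: the entry starts a
run, it is not moved onto an equal entry, and it is not swapped with its left neighbour. -/
def canonicalTargets (n : ℕ) (X : ℕ → ℕ) (i : ℕ) : Finset ℕ :=
  (Finset.range n).filter fun j =>
    X j ≠ X i ∧ (i = 0 ∨ (X (i - 1) ≠ X i ∧ j + 1 ≠ i))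

theorem exists_canonical_move (n : ℕ) (X : ℕ → ℕ) (i j : ℕ) (hi : i < n) (hj : j < n) :
    X ∘ moveIdx i j = X ∨
      ∃ i' < n, ∃ j' ∈ canonicalTargets n X i', X ∘ moveIdx i j = X ∘ moveIdx i' j' := by
  induction i using Nat.strong_induction_on generalizing j with
  | _ i ihi =>
  induction hm : (i - j) + (j - i) using Nat.strong_induction_on generalizing j with
  | _ m ihm =>
  by_cases hX : X i = X j
  · rcases lt_trichotomy i j with h | rfl | h
    · rw [comp_moveIdx_target_pred X h hX]
      exact ihm _ (by omega) (j - 1) (by omega) rfl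
    · exact Or.inl (comp_moveIdx_self X i)
    · rw [comp_moveIdx_target_succ X h hX]
      exact ihm _ (by omega) (j + 1) (by omega) rfl
  by_cases h0 : i = 0
  · exact Or.inr ⟨i, hi, j, by simp [canonicalTargets, hj, h0, h0 ▸ Ne.symm hX], rfl⟩
  by_cases hrun : X (i - 1) = X i
  · rw [comp_moveIdx_source_pred X h0 hrun]
    exact ihi (i - 1) (by omega) j (by omega) hj
  by_cases hadj : j + 1 = i
  · subst hadj
    rw [moveIdx_succ_swap]
    exact ihi j (by omega) (j + 1) (by omega) hi
  · exact Or.inr ⟨i, hi, j, by simp [canonicalTargets, hj, hrun, hadj, Ne.symm hX], rfl⟩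

theorem card_canonicalTargets_le {n r : ℕ} {X : ℕ → ℕ} {i : ℕ} (hi : i < n)
    (hr : r ≤ ((Finset.range n).filter fun j => X j = X i).card) :
    (canonicalTargets n X i).card ≤ if i = 0 then n - r else n - r - 1 := by
  have hne : ((Finset.range n).filter fun j => X j ≠ X i).card ≤ n - r := by
    have := Finset.card_filter_add_card_filter_not (s := Finset.range n) (fun j => X j = X i)
    rw [Finset.card_range] at this
    simp only [ne_eq]
    omega
  split_ifs with h0
  · refine (Finset.card_le_card fun j hj => ?_).trans hne
    simp only [canonicalTargets, Finset.mem_filter] at hj ⊢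
    exact ⟨hj.1, hj.2.1⟩
  by_cases hrun : X (i - 1) = X i
  · have : canonicalTargets n X i = ∅ := by
      simp [canonicalTargets, h0, hrun]
    simp [this]
  · have hmem : i - 1 ∈ (Finset.range n).filter fun j => X j ≠ X i := by
      simp only [Finset.mem_filter, Finset.mem_range]
      exact ⟨by omega, hrun⟩
    have hsub : canonicalTargets n X i ⊆
        ((Finset.range n).filter fun j => X j ≠ X i).erase (i - 1) := by
      intro j hj
      simp only [canonicalTargets, Finset.mem_filter, Finset.mem_erase] at hj ⊢
      refine ⟨?_, hj.1, hj.2.1⟩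
      have := hj.2.2
      omega
    have := Finset.card_le_card hsub
    rw [Finset.card_erase_of_mem hmem] at this
    omega

/-- A finite sequence extended by `0` to all natural indices. -/
def extendSeq {n : ℕ} (f : Fin n → ℕ) (k : ℕ) : ℕ := (List.ofFn f).getD k 0

theorem extendSeq_val {n : ℕ} (f : Fin n → ℕ) (k : Fin n) : extendSeq f k = f k := by
  simp [extendSeq]

/-- A finite set containing all sequences obtained from `f` by at most one translocation. -/
def moveBall {n : ℕ} (f : Fin n → ℕ) : Finset (Fin n → ℕ) :=
  insert f (((Finset.range n).sigma (canonicalTargets n (extendSeq f))).image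
    fun p k => extendSeq f (moveIdx p.1 p.2 k))

theorem count_ofFn_eq_card {n : ℕ} {α : Type*} [DecidableEq α] (f : Fin n → α) (a : α) :
    (List.ofFn f).count a = (Finset.univ.filter fun i => f i = a).card := by
  rw [← Multiset.coe_count, ← Fin.univ_val_map, Multiset.count_map]
  simp only [eq_comm (a := a)]
  rfl

theorem card_moveBall_le {n r : ℕ} (hr : 0 < r) (hrn : r < n) (f : Fin n → ℕ)
    (hf : ∀ a ∈ List.ofFn f, r ≤ (List.ofFn f).count a) :
    (moveBall f).card ≤ 1 + (n - 1) ^ 2 - (r - 1) * n := by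
  have hcount : ∀ i < n, (canonicalTargets n (extendSeq f) i).card ≤
      if i = 0 then n - r else n - r - 1 := by
    intro i hi
    refine card_canonicalTargets_le hi ?_
    refine (hf (f ⟨i, hi⟩) (by simp)).trans ?_
    rw [count_ofFn_eq_card, ← Finset.card_map Fin.valEmbedding]
    refine Finset.card_le_card fun j hj => ?_
    simp only [Finset.mem_map, Finset.mem_filter, Finset.mem_univ, true_and] at hj
    obtain ⟨k, hk, rfl⟩ := hj
    simp only [Finset.mem_filter, Finset.mem_range, Fin.valEmbedding_apply, extendSeq_val]
    refine ⟨k.2, ?_⟩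
    have := extendSeq_val f ⟨i, hi⟩
    simp only at this
    rw [this]
    exact hk
  have hsum : ∑ i ∈ Finset.range n, (canonicalTargets n (extendSeq f) i).card ≤
      (n - r) + (n - 1) * (n - r - 1) := by
    refine (Finset.sum_le_sum fun i hi => hcount i (Finset.mem_range.1 hi)).trans ?_
    obtain ⟨m, rfl⟩ : ∃ m, n = m + 1 := ⟨n - 1, by omega⟩
    rw [Finset.sum_range_succ']
    simp [add_comm]
  have hcard : (moveBall f).card ≤ ((n - r) + (n - 1) * (n - r - 1)) + 1 := by
    refine (Finset.card_insert_le _ _).trans (Nat.add_le_add_right ?_ 1)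
    refine Finset.card_image_le.trans ?_
    rwa [Finset.card_sigma]
  refine hcard.trans (Nat.le_sub_of_add_le ?_)
  obtain ⟨s, rfl⟩ : ∃ s, r = s + 1 := ⟨r - 1, by omega⟩
  obtain ⟨m, rfl⟩ : ∃ m, n = s + 1 + m + 1 := ⟨n - (s + 2), by omega⟩
  have h1 : s + 1 + m + 1 - (s + 1) = m + 1 := by omega
  rw [h1]
  simp only [Nat.add_sub_cancel]
  apply le_of_eq
  ring

theorem mem_moveBall_of_lists {n : ℕ} {f g : Fin n → ℕ} {a : ℕ} {x₁ x₂ u₁ u₂ : List ℕ}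
    (hf : List.ofFn f = x₁ ++ a :: x₂) (hg : List.ofFn g = u₁ ++ a :: u₂)
    (h : x₁ ++ x₂ = u₁ ++ u₂) : g ∈ moveBall f := by
  have hlf : n = x₁.length + (x₂.length + 1) := by simpa using congrArg List.length hf
  have hlg : n = u₁.length + (u₂.length + 1) := by simpa using congrArg List.length hg
  have hmove : ∀ k < n, extendSeq g k = extendSeq f (moveIdx x₁.length u₁.length k) := by
    intro k hk
    simp only [extendSeq, hf, hg, List.getD_eq_getElem?_getD]
    congr 1
    rcases List.append_eq_append_iff.1 h with ⟨q, rfl, rfl⟩ | ⟨q, rfl, rfl⟩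
    · simp only [moveIdx, List.length_append] at *
      grind
    · simp only [moveIdx, List.length_append] at *
      grind
  have hg' : g = fun k : Fin n => extendSeq f (moveIdx x₁.length u₁.length k) := by
    funext k
    rw [← hmove k k.2, extendSeq_val]
  rcases exists_canonical_move n (extendSeq f) x₁.length u₁.length (by omega) (by omega) with
    h | ⟨i, hi, j, hj, h⟩
  · refine Finset.mem_insert.2 (Or.inl ?_)
    rw [hg']
    funext k
    rw [← extendSeq_val f k]
    exact congrFun h k
  · refine Finset.mem_insert.2 (Or.inr (Finset.mem_image.2 ⟨⟨i, j⟩, ?_, ?_⟩))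
    · exact Finset.mem_sigma.2 ⟨Finset.mem_range.2 hi, hj⟩
    · rw [hg']
      funext k
      exact (congrFun h k).symm

theorem List.Sublist.exists_split_of_length_lt {α : Type*} {z x : List α} (h : z.Sublist x)
    (hlt : z.length < x.length) :
    ∃ a x₁ x₂, x = x₁ ++ a :: x₂ ∧ z.Sublist (x₁ ++ x₂) := by
  induction h with
  | slnil => simp at hlt
  | @cons z x b h ih => exact ⟨b, [], x, rfl, h⟩
  | @cons_cons z x b h ih =>
    obtain ⟨a, x₁, x₂, rfl, h'⟩ := ih (by simpa using hlt)
    exact ⟨a, b :: x₁, x₂, rfl, h'.cons_cons b⟩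

theorem List.Sublist.exists_split_of_count_lt {α : Type*} [DecidableEq α] {z y : List α} {a : α}
    (h : z.Sublist y) (hlt : z.count a < y.count a) :
    ∃ z₁ z₂, z = z₁ ++ z₂ ∧ (z₁ ++ a :: z₂).Sublist y := by
  induction h with
  | slnil => simp at hlt
  | @cons z y b h ih =>
    by_cases hb : b = a
    · subst hb
      exact ⟨[], z, rfl, h.cons_cons b⟩
    · obtain ⟨z₁, z₂, rfl, h'⟩ := ih (by simpa [List.count_cons, hb] using hlt)
      exact ⟨z₁, z₂, rfl, h'.cons b⟩
  | @cons_cons z y b h ih =>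
    obtain ⟨z₁, z₂, rfl, h'⟩ := ih (by simpa [List.count_cons] using hlt)
    exact ⟨b :: z₁, z₂, rfl, h'.cons_cons b⟩

/-- The sequences reachable from `f` by at most `t` translocations. -/
def iterBall {n : ℕ} : ℕ → (Fin n → ℕ) → Finset (Fin n → ℕ)
  | 0, f => {f}
  | t + 1, f =>
    ((moveBall f).filter fun g => (List.ofFn g).Perm (List.ofFn f)).biUnion (iterBall t)

theorem card_iterBall_le {n r : ℕ} (hr : 0 < r) (hrn : r < n) (t : ℕ) (f : Fin n → ℕ)
    (hf : ∀ a ∈ List.ofFn f, r ≤ (List.ofFn f).count a) :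
    (iterBall t f).card ≤ (1 + (n - 1) ^ 2 - (r - 1) * n) ^ t := by
  induction t generalizing f with
  | zero => simp [iterBall]
  | succ t ih =>
    rw [iterBall, pow_succ']
    refine (Finset.card_biUnion_le_card_mul _ _ _ fun g hg => ih g ?_).trans
      (Nat.mul_le_mul_right _
        ((Finset.card_filter_le _ _).trans (card_moveBall_le hr hrn f hf)))
    have hp := (Finset.mem_filter.1 hg).2
    intro a ha
    rw [hp.count_eq]
    exact hf a (hp.mem_iff.1 ha)

theorem mem_iterBall {n : ℕ} (t : ℕ) (f g : Fin n → ℕ) (hfg : (List.ofFn f).Perm (List.ofFn g))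
    (z : List ℕ) (hzf : z.Sublist (List.ofFn f)) (hzg : z.Sublist (List.ofFn g))
    (hz : n ≤ z.length + t) : g ∈ iterBall t f := by
  induction t generalizing f z with
  | zero =>
    have h1 := hzf.eq_of_length_le (by simpa using hz)
    have h2 := hzg.eq_of_length_le (by simpa using hz)
    simpa [iterBall] using List.ofFn_injective (h2.symm.trans h1)
  | succ t ih =>
    rw [iterBall, Finset.mem_biUnion]
    by_cases hzt : n ≤ z.length + t
    · exact ⟨f, by simp [moveBall], ih f hfg z hzf hzg hzt⟩
    obtain ⟨a, x₁, x₂, hx, hzx⟩ := hzf.exists_split_of_length_lt (by simp; omega)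
    have hcount : z.count a < (List.ofFn g).count a := by
      rw [← hfg.count_eq, hx]
      have := hzx.count_le a
      simp only [List.count_append, List.count_cons_self] at this ⊢
      omega
    obtain ⟨z₁, z₂, rfl, hzy⟩ := hzg.exists_split_of_count_lt hcount
    obtain ⟨u₁, u₂, hu, h₁, h₂⟩ := List.append_sublist_iff.1 hzx
    have hlen : (u₁ ++ a :: u₂).length = n := by
      have e1 := congrArg List.length hx
      have e2 := congrArg List.length hu
      simp at e1 e2 ⊢
      omega
    obtain ⟨f', hf'⟩ : ∃ f' : Fin n → ℕ, List.ofFn f' = u₁ ++ a :: u₂ := by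
      subst hlen
      exact ⟨(u₁ ++ a :: u₂).get, List.ofFn_get _⟩
    have hperm : (List.ofFn f').Perm (List.ofFn f) := by
      rw [hf', hx]
      refine List.perm_middle.trans (List.Perm.trans ?_ List.perm_middle.symm)
      rw [hu]
    refine ⟨f', Finset.mem_filter.2 ⟨mem_moveBall_of_lists hx hf' hu, hperm⟩,
      ih f' (hperm.trans hfg) (z₁ ++ a :: z₂) ?_ hzy ?_⟩
    · rw [hf']
      exact h₁.append (h₂.cons_cons a)
    · simp at hz ⊢
      omega

theorem exists_common_sublist_of_mdist_le {n : ℕ} {α : Type*} {x y : Fin n → α} {t : ℕ}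
    (h : mdist x y ≤ t) :
    ∃ z : List α, z.Sublist (List.ofFn x) ∧ z.Sublist (List.ofFn y) ∧ n ≤ z.length + t := by
  have hmem := Nat.sSup_mem
    (s := {k | ∃ z : List α, z.length = k ∧ z.Sublist (List.ofFn x) ∧ z.Sublist (List.ofFn y)})
    ⟨0, [], rfl, List.nil_sublist _, List.nil_sublist _⟩
    ⟨n, by
      rintro k ⟨z, rfl, hz, -⟩
      simpa using hz.length_le⟩
  obtain ⟨z, hz, hzx, hzy⟩ := hmem
  refine ⟨z, hzx, hzy, ?_⟩
  have : n - z.length ≤ t := by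
    rw [hz]
    exact h
  omega

theorem perm_ofFn_mreg {n : ℕ} (r : ℕ) (σ : Equiv.Perm (Fin n)) :
    (List.ofFn (mreg r σ)).Perm (List.ofFn (mreg r (1 : Equiv.Perm (Fin n)))) :=
  Equiv.Perm.ofFn_comp_perm σ (mreg r (1 : Equiv.Perm (Fin n)))

theorem le_count_mreg {n r : ℕ} (hr : 0 < r) (hdvd : r ∣ n) (σ : Equiv.Perm (Fin n)) (a : ℕ)
    (ha : a ∈ List.ofFn (mreg r σ)) : r ≤ (List.ofFn (mreg r σ)).count a := by
  rw [(perm_ofFn_mreg r σ).count_eq]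
  rw [(perm_ofFn_mreg r σ).mem_iff] at ha
  obtain ⟨k, rfl⟩ := (List.mem_ofFn' _ _).1 ha
  rw [count_ofFn_eq_card]
  obtain ⟨q, rfl⟩ := hdvd
  have hq : (k : ℕ) / r < q := Nat.div_lt_of_lt_mul k.2
  have hlt : ∀ s : Fin r, r * ((k : ℕ) / r) + s < r * q := fun s =>
    calc r * ((k : ℕ) / r) + s < r * ((k : ℕ) / r) + r := by omega
      _ = r * ((k : ℕ) / r + 1) := by ring
      _ ≤ r * q := Nat.mul_le_mul_left r hq
  calc r = (Finset.univ.image fun s : Fin r => (⟨_, hlt s⟩ : Fin (r * q))).card := by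
        rw [Finset.card_image_of_injective, Finset.card_univ, Fintype.card_fin]
        intro s t hst
        simpa [Fin.ext_iff] using hst
    _ ≤ _ := by
        refine Finset.card_le_card fun j hj => ?_
        obtain ⟨s, -, rfl⟩ := Finset.mem_image.1 hj
        simp [mreg, Nat.mul_add_div hr, Nat.div_eq_of_lt s.2]

theorem card_mreg_fiber_le {n r : ℕ} (hr : 0 < r) (hdvd : r ∣ n) (π : Equiv.Perm (Fin n)) :
    (Finset.univ.filter fun σ : Equiv.Perm (Fin n) => mreg r σ = mreg r π).card ≤
      r.factorial ^ (n / r) := by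
  have hlt : ∀ i : Fin n, (i : ℕ) / r < n / r := fun i =>
    Nat.div_lt_div_of_lt_of_dvd hdvd i.2
  let c : Fin n → Fin (n / r) := fun i => ⟨(i : ℕ) / r, hlt i⟩
  have hfiber : ∀ q : Fin (n / r), Fintype.card {i : Fin n // c i = q} ≤ r := by
    intro q
    have hinj : Function.Injective
        (fun i : {i : Fin n // c i = q} => (⟨(i : ℕ) % r, Nat.mod_lt _ hr⟩ : Fin r)) := by
      rintro ⟨i, hi⟩ ⟨j, hj⟩ hij
      have h1 : (i : ℕ) % r = (j : ℕ) % r := congrArg Fin.val hij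
      have h2 : (i : ℕ) / r = (j : ℕ) / r := congrArg Fin.val (hi.trans hj.symm)
      have h3 := Nat.div_add_mod (i : ℕ) r
      rw [h1, h2, Nat.div_add_mod] at h3
      exact Subtype.ext (Fin.ext h3.symm)
    simpa using Fintype.card_le_of_injective _ hinj
  calc _ ≤ (Finset.univ.filter fun g : Equiv.Perm (Fin n) => c ∘ g = c).card := by
        refine Finset.card_le_card_of_injOn (fun σ => σ * π⁻¹) ?_
          ((mul_left_injective π⁻¹).injOn)
        intro σ hσ
        simp only [Finset.coe_filter, Finset.mem_univ, true_and, Set.mem_ofPred_eq] at hσ ⊢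
        funext i
        have := congrFun hσ (π⁻¹ i)
        simpa [mreg, c, Fin.ext_iff] using this
    _ = ∏ q, (Fintype.card {i : Fin n // c i = q}).factorial := by
        rw [← DomMulAct.stabilizer_card c, Fintype.card_subtype]
    _ ≤ ∏ _q : Fin (n / r), r.factorial :=
        Finset.prod_le_prod' fun q _ => Nat.factorial_le (hfiber q)
    _ = r.factorial ^ (n / r) := by simp

theorem Mset_eq_image (n r : ℕ) :
    Mset n r = (Finset.univ.image (mreg (n := n) r) : Finset (Fin n → ℕ)) := by
  ext m
  simp [Mset, eq_comm]

theorem factorial_le_card_image_mreg {n r : ℕ} (hr : 0 < r) (hdvd : r ∣ n) :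
    n.factorial ≤
      r.factorial ^ (n / r) * (Finset.univ.image (mreg (n := n) r)).card := by
  have := Finset.card_le_mul_card_image (f := mreg (n := n) r) Finset.univ (r.factorial ^ (n / r))
    (by
      intro m hm
      obtain ⟨π, -, rfl⟩ := Finset.mem_image.1 hm
      exact card_mreg_fiber_le hr hdvd π)
  simpa [Fintype.card_perm] using this

theorem lcsLen_comm {α : Type*} (x y : List α) : lcsLen x y = lcsLen y x := by
  simp only [lcsLen, and_comm]

theorem mdist_comm {n : ℕ} {α : Type*} (x y : Fin n → α) : mdist x y = mdist y x := by
  simp only [mdist, lcsLen_comm]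

/-- Gilbert–Varshamov type bound: if `n/r ≠ 2` and `C ⊆ M_r(S_n)` is a
code of maximal cardinality among codes whose minimum `r`-regular Ulam distance between
distinct codewords equals `d`, then
`n! / ((r!)^{n/r} · (1 + (n-1)² - (r-1)n)^{d-1}) ≤ |C|`. -/
theorem maximal_code_card_lower_bound (n r d : ℕ) (hn : 0 < n) (hr : 0 < r)
    (hdvd : r ∣ n) (hnr : n / r ≠ 2) (hd : 0 < d) (C : Set (Fin n → ℕ))
    (hsub : C ⊆ Mset n r)
    (hmin : ∀ x ∈ C, ∀ y ∈ C, x ≠ y → d ≤ mdist x y)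
    (hmin' : ∃ x ∈ C, ∃ y ∈ C, x ≠ y ∧ mdist x y = d)
    (hmax : ∀ C' : Set (Fin n → ℕ), C' ⊆ Mset n r →
      (∀ x ∈ C', ∀ y ∈ C', x ≠ y → d ≤ mdist x y) →
      (∃ x ∈ C', ∃ y ∈ C', x ≠ y ∧ mdist x y = d) → C'.ncard ≤ C.ncard) :
    (n.factorial : ℝ) /
        ((r.factorial : ℝ) ^ (n / r) *
          ((1 + (n - 1) ^ 2 - (r - 1) * n : ℕ) : ℝ) ^ (d - 1)) ≤
      (C.ncard : ℝ) := by
  have hMfin : (Mset n r).Finite := by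
    rw [Mset_eq_image]
    exact Finset.finite_toSet _
  have hCfin : C.Finite := hMfin.subset hsub
  have hrn : r < n := by
    refine lt_of_le_of_ne (Nat.le_of_dvd hn hdvd) ?_
    rintro rfl
    obtain ⟨x, hx, y, hy, hxy, -⟩ := hmin'
    obtain ⟨σ, rfl⟩ := hsub hx
    obtain ⟨π, rfl⟩ := hsub hy
    refine hxy (funext fun i => ?_)
    simp [mreg, Nat.div_eq_of_lt (σ i).2, Nat.div_eq_of_lt (π i).2]
  have hcover : ∀ m ∈ Mset n r, ∃ c ∈ C, mdist c m ≤ d - 1 := by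
    intro m hm
    by_contra! hfar
    have hfar' : ∀ c ∈ C, d ≤ mdist c m := fun c hc => by
      have := hfar c hc
      omega
    have hmC : m ∉ C := fun hmC => by
      have := hfar m hmC
      have hself : mdist m m = 0 := by
        have : n ≤ lcsLen (List.ofFn m) (List.ofFn m) := by
          refine le_csSup ⟨n, ?_⟩ ⟨List.ofFn m, by simp, List.Sublist.refl _, List.Sublist.refl _⟩
          rintro k ⟨z, rfl, hz, -⟩
          simpa using hz.length_le
        unfold mdist
        omega
      omega
    have hle := hmax (insert m C) (Set.insert_subset hm hsub) (by
        intro x hx y hy hxy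
        rcases hx with rfl | hx <;> rcases hy with rfl | hy
        · exact absurd rfl hxy
        · rw [mdist_comm]
          exact hfar' y hy
        · exact hfar' x hx
        · exact hmin x hx y hy hxy)
      (by
        obtain ⟨x, hx, y, hy, h⟩ := hmin'
        exact ⟨x, Or.inr hx, y, Or.inr hy, h⟩)
    rw [Set.ncard_insert_of_notMem hmC hCfin] at hle
    omega
  have hsubset : Finset.univ.image (mreg (n := n) r) ⊆
      hCfin.toFinset.biUnion (iterBall (d - 1)) := by
    intro m hm
    have hm' : m ∈ Mset n r := by
      rw [Mset_eq_image]
      exact hm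
    obtain ⟨c, hc, hcm⟩ := hcover m hm'
    obtain ⟨z, hzc, hzm, hz⟩ := exists_common_sublist_of_mdist_le hcm
    refine Finset.mem_biUnion.2 ⟨c, hCfin.mem_toFinset.2 hc, mem_iterBall _ c m ?_ z hzc hzm hz⟩
    obtain ⟨σ, rfl⟩ := hsub hc
    obtain ⟨π, rfl⟩ := hm'
    exact (perm_ofFn_mreg r σ).trans (perm_ofFn_mreg r π).symm
  have hcard : (Finset.univ.image (mreg (n := n) r)).card ≤
      C.ncard * (1 + (n - 1) ^ 2 - (r - 1) * n) ^ (d - 1) := by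
    rw [Set.ncard_eq_toFinset_card C hCfin]
    refine (Finset.card_le_card hsubset).trans
      (Finset.card_biUnion_le_card_mul _ _ _ fun c hc => ?_)
    obtain ⟨σ, rfl⟩ := hsub (hCfin.mem_toFinset.1 hc)
    exact card_iterBall_le hr hrn _ _ (le_count_mreg hr hdvd σ)
  have hnat : n.factorial ≤ C.ncard *
      (r.factorial ^ (n / r) * (1 + (n - 1) ^ 2 - (r - 1) * n) ^ (d - 1)) :=
    (factorial_le_card_image_mreg hr hdvd).trans
      ((Nat.mul_le_mul_left _ hcard).trans (le_of_eq (by ring)))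
  refine div_le_of_le_mul₀ (by positivity) (by positivity) ?_
  exact_mod_cast hnat
end
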